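/- Let n be an odd integer and let k be an integer with 2 ≤ k ≤ ⌊n/2⌋ such that n ≡ 1 (mod k) (i.e., writing n = a·k + r with 0 ≤ r < k, one has r = 1). Then mbt(C(n,k)) = Δ(C(n,k)) + 1 = 5. -/

import Mathlib

open SimpleGraph

/-- The circulant graph `C(ℤ_n, S)`: vertices are `ZMod n`, and distinct `i, j` are
adjacent iff `i - j ≡ s` or `i - j ≡ -s (mod n)` for some `s ∈ S`. -/
def circulant (n : ℕ) (S : Set ℤ) : SimpleGraph (ZMod n) :=
  SimpleGraph.fromRel fun i j => ∃ s ∈ S, i - j = (s : ZMod n)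

/-- `C(n,k) = C(ℤ_n, {1, k})`. -/
def circ (n k : ℕ) : SimpleGraph (ZMod n) := circulant n {1, (k : ℤ)}

/-- The maximum degree `Δ(G)` of a graph. -/
noncomputable def maxDeg {V : Type*} (G : SimpleGraph V) : ℕ :=
  sSup (Set.range fun v => (G.neighborSet v).ncard)

/-- `x` lies strictly between positions `a` and `b` on the circular layout
(cut open along the linear order of `Fin N`). -/
def ChordBetween {N : ℕ} (x a b : Fin N) : Prop := min a b < x ∧ x < max a b

/-- The chords joining the positions `a,b` and `c,d` on a circle cross iff exactly one of
`c, d` lies strictly between `a` and `b`. -/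
def ChordCross {N : ℕ} (a b c d : Fin N) : Prop :=
  Xor' (ChordBetween c a b) (ChordBetween d a b)

/-- `G` admits a matching book embedding in `m` pages: there is a circular layout
(a bijection of the vertices with `Fin (Nat.card V)`) and a proper edge coloring with
`m` colors such that crossing edges get distinct colors. -/
def HasMBE {V : Type*} (G : SimpleGraph V) (m : ℕ) : Prop :=
  ∃ (σ : V ≃ Fin (Nat.card V)) (col : V → V → Fin m),
    (∀ u v, G.Adj u v → col u v = col v u) ∧
    (∀ u v w, G.Adj u v → G.Adj u w → v ≠ w → col u v ≠ col u w) ∧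
    (∀ a b c d, G.Adj a b → G.Adj c d →
      ChordCross (σ a) (σ b) (σ c) (σ d) → col a b ≠ col c d)

/-- The matching book thickness `mbt(G)`. -/
noncomputable def mbt {V : Type*} (G : SimpleGraph V) : ℕ :=
  sInf {m | HasMBE G m}

/-- The remainder algorithm from the paper: `k₀ = k`, `r₀ = r`,
`k_{i+1} = k_i - r_i`, `r_{i+1} = k_i mod k_{i+1}`. -/
def euclidSeq (k r : ℕ) : ℕ → ℕ × ℕ
  | 0 => (k, r)
  | i + 1 =>
      ((euclidSeq k r i).1 - (euclidSeq k r i).2,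
       (euclidSeq k r i).1 % ((euclidSeq k r i).1 - (euclidSeq k r i).2))


/-! ### The construction, in position coordinates

A position is a pair `(row, place in row)`, ordered lexicographically. Each page is a set of
left-to-right oriented chords. -/

/-- Lexicographic order on positions. -/
def posLt (j t l s : ℕ) : Prop := j < l ∨ (j = l ∧ t < s)

/-- Pages for `k` odd. -/
def pageOdd (a k c j t l s : ℕ) : Prop :=
  (c = 0 ∧ l = j ∧ s = t + 1 ∧ s < k ∧ j < a ∧ t % 2 = 0 ∧ ¬ (j = 0 ∧ t = 0)) ∨
  (c = 0 ∧ j % 2 = 0 ∧ l = j + 1 ∧ l < a ∧ t + 1 = k ∧ s + 1 = k) ∨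
  (c = 0 ∧ j = 0 ∧ t = 0 ∧ l = a ∧ s = 0) ∨
  (c = 1 ∧ l = j ∧ s = t + 1 ∧ s < k ∧ j < a ∧ t % 2 = 1) ∨
  (c = 1 ∧ j % 2 = 1 ∧ l = j + 1 ∧ l < a ∧ t = 0 ∧ s = 0) ∨
  (c = 1 ∧ j + 1 = a ∧ t = 0 ∧ l = a ∧ s = 0) ∨
  (c = 2 ∧ j % 2 = 0 ∧ l = j + 1 ∧ l < a ∧ t + s + 1 = k) ∨
  (c = 3 ∧ j % 2 = 1 ∧ l = j + 1 ∧ l < a ∧ t + s + 1 = k) ∨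
  (c = 3 ∧ j = 0 ∧ l + 1 = a ∧ t + s + 2 = k) ∨
  (c = 3 ∧ j + 1 = a ∧ t + 1 = k ∧ l = a ∧ s = 0) ∨
  (c = 4 ∧ j = 0 ∧ t = 0 ∧ l = 0 ∧ s = 1) ∨
  (c = 4 ∧ j = 0 ∧ t + 1 = k ∧ l = a ∧ s = 0)

/-- Pages for `k` even. -/
def pageEven (a k c j t l s : ℕ) : Prop :=
  (c = 0 ∧ l = j ∧ s = t + 1 ∧ s < k ∧ j < a ∧ t % 2 = 0 ∧ ¬ (j + 1 = a ∧ t = 0)) ∨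
  (c = 0 ∧ j + 1 = a ∧ t = 0 ∧ l = a ∧ s = 0) ∨
  (c = 1 ∧ l = j ∧ s = t + 1 ∧ s < k ∧ j < a ∧ t % 2 = 1) ∨
  (c = 1 ∧ j % 2 = 0 ∧ l = j + 1 ∧ l < a ∧ t + 1 = k ∧ s + 1 = k) ∨
  (c = 1 ∧ j = 0 ∧ t = 0 ∧ l = a ∧ s = 0) ∨
  (c = 2 ∧ j % 2 = 0 ∧ l = j + 1 ∧ l < a ∧ t + s + 1 = k) ∨
  (c = 3 ∧ j % 2 = 1 ∧ l = j + 1 ∧ l < a ∧ t + s + 1 = k) ∨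
  (c = 3 ∧ j = 0 ∧ l + 1 = a ∧ t + s + 2 = k) ∨
  (c = 3 ∧ j + 1 = a ∧ t + 1 = k ∧ l = a ∧ s = 0) ∨
  (c = 4 ∧ j + 1 = a ∧ t = 0 ∧ l = j ∧ s = 1) ∨
  (c = 4 ∧ j % 2 = 1 ∧ l = j + 1 ∧ l < a ∧ t = 0 ∧ s = 0) ∨
  (c = 4 ∧ j = 0 ∧ t + 1 = k ∧ l = a ∧ s = 0)

/-- Two left-to-right chords are equal, or disjoint and non-crossing. -/
def chordsOk (j t l s j' t' l' s' : ℕ) : Prop :=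
  (j = j' ∧ t = t' ∧ l = l' ∧ s = s') ∨ posLt l s j' t' ∨ posLt l' s' j t ∨
  (posLt j t j' t' ∧ posLt l' s' l s) ∨ (posLt j' t' j t ∧ posLt l s l' s')

set_option maxHeartbeats 4000000 in
theorem pageOdd_ok {a k c j t l s j' t' l' s' : ℕ} (ha : a % 2 = 0) (ha2 : 2 ≤ a)
    (hk : k % 2 = 1) (hk3 : 3 ≤ k)
    (h : pageOdd a k c j t l s) (h' : pageOdd a k c j' t' l' s') :
    posLt j t l s ∧ chordsOk j t l s j' t' l' s' := by
  unfold pageOdd at h h'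
  unfold chordsOk posLt
  rcases h with h | h | h | h | h | h | h | h | h | h | h | h <;>
  rcases h' with h' | h' | h' | h' | h' | h' | h' | h' | h' | h' | h' | h' <;>
  first
  | (exfalso; have := h.1; have := h'.1; omega)
  | omega

set_option maxHeartbeats 4000000 in
theorem pageEven_ok {a k c j t l s j' t' l' s' : ℕ} (ha : a % 2 = 0) (ha2 : 2 ≤ a)
    (hk : k % 2 = 0) (hk3 : 2 ≤ k)
    (h : pageEven a k c j t l s) (h' : pageEven a k c j' t' l' s') :
    posLt j t l s ∧ chordsOk j t l s j' t' l' s' := by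
  unfold pageEven at h h'
  unfold chordsOk posLt
  rcases h with h | h | h | h | h | h | h | h | h | h | h | h <;>
  rcases h' with h' | h' | h' | h' | h' | h' | h' | h' | h' | h' | h' | h' <;>
  first
  | (exfalso; have := h.1; have := h'.1; omega)
  | omega

/-- place in row, for boustrophedon order -/
def place (k j i : ℕ) : ℕ := if j % 2 = 0 then i else k - 1 - i

/-- numerical position -/
def posNum (k v : ℕ) : ℕ := v / k * k + place k (v / k) (v % k)

/-- What we need from a system of pages. -/
structure GoodPages (a k : ℕ) (Q : ℕ → ℕ → ℕ → ℕ → ℕ → Prop) : Prop where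
  ok : ∀ {c j t l s j' t' l' s' : ℕ}, Q c j t l s → Q c j' t' l' s' →
    posLt j t l s ∧ chordsOk j t l s j' t' l' s'
  h1 : ∀ j t, j < a → t + 1 < k → ∃ c < 5, Q c j t j (t + 1)
  h2 : ∀ j, j % 2 = 0 → j + 1 < a → ∃ c < 5, Q c j (k - 1) (j + 1) (k - 1)
  h2' : ∀ j, j % 2 = 1 → j + 1 < a → ∃ c < 5, Q c j 0 (j + 1) 0
  h3 : ∃ c < 5, Q c (a - 1) 0 a 0
  h4 : ∃ c < 5, Q c 0 0 a 0
  h5 : ∀ j t s, j + 1 < a → t + s + 1 = k → ∃ c < 5, Q c j t (j + 1) s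
  h6 : ∀ t s, t + s + 2 = k → ∃ c < 5, Q c 0 t (a - 1) s
  h7 : ∃ c < 5, Q c (a - 1) (k - 1) a 0
  h8 : ∃ c < 5, Q c 0 (k - 1) a 0

theorem goodPages_odd {a k : ℕ} (ha : a % 2 = 0) (ha2 : 2 ≤ a)
    (hk : k % 2 = 1) (hk3 : 3 ≤ k) : GoodPages a k (pageOdd a k) where
  ok := pageOdd_ok ha ha2 hk hk3
  h1 := by
    intro j t hj ht
    by_cases h0 : j = 0 ∧ t = 0
    · exact ⟨4, by norm_num, Or.inr (Or.inr (Or.inr (Or.inr (Or.inr (Or.inr (Or.inr (Or.inr (Or.inr (Or.inr (Or.inl (by omega)))))))))))⟩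
    rcases Nat.mod_two_eq_zero_or_one t with h | h
    · exact ⟨0, by norm_num, Or.inl (by omega)⟩
    · exact ⟨1, by norm_num, Or.inr (Or.inr (Or.inr (Or.inl (by omega))))⟩
  h2 := fun j _ _ => ⟨0, by norm_num, Or.inr (Or.inl (by omega))⟩
  h2' := fun j _ _ => ⟨1, by norm_num, Or.inr (Or.inr (Or.inr (Or.inr (Or.inl (by omega)))))⟩
  h3 := ⟨1, by norm_num, Or.inr (Or.inr (Or.inr (Or.inr (Or.inr (Or.inl (by omega))))))⟩
  h4 := ⟨0, by norm_num, Or.inr (Or.inr (Or.inl (by omega)))⟩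
  h5 := by
    intro j t s hj ht
    rcases Nat.mod_two_eq_zero_or_one j with h | h
    · exact ⟨2, by norm_num, Or.inr (Or.inr (Or.inr (Or.inr (Or.inr (Or.inr (Or.inl (by omega)))))))⟩
    · exact ⟨3, by norm_num, Or.inr (Or.inr (Or.inr (Or.inr (Or.inr (Or.inr (Or.inr (Or.inl (by omega))))))))⟩
  h6 := fun t s _ => ⟨3, by norm_num, Or.inr (Or.inr (Or.inr (Or.inr (Or.inr (Or.inr (Or.inr (Or.inr (Or.inl (by omega)))))))))⟩
  h7 := ⟨3, by norm_num, Or.inr (Or.inr (Or.inr (Or.inr (Or.inr (Or.inr (Or.inr (Or.inr (Or.inr (Or.inl (by omega))))))))))⟩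
  h8 := ⟨4, by norm_num, Or.inr (Or.inr (Or.inr (Or.inr (Or.inr (Or.inr (Or.inr (Or.inr (Or.inr (Or.inr (Or.inr (by omega)))))))))))⟩

theorem goodPages_even {a k : ℕ} (ha : a % 2 = 0) (ha2 : 2 ≤ a)
    (hk : k % 2 = 0) (hk3 : 2 ≤ k) : GoodPages a k (pageEven a k) where
  ok := pageEven_ok ha ha2 hk hk3
  h1 := by
    intro j t hj ht
    by_cases h0 : j + 1 = a ∧ t = 0
    · exact ⟨4, by norm_num, Or.inr (Or.inr (Or.inr (Or.inr (Or.inr (Or.inr (Or.inr (Or.inr (Or.inr (Or.inl (by omega))))))))))⟩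
    rcases Nat.mod_two_eq_zero_or_one t with h | h
    · exact ⟨0, by norm_num, Or.inl (by omega)⟩
    · exact ⟨1, by norm_num, Or.inr (Or.inr (Or.inl (by omega)))⟩
  h2 := fun j _ _ => ⟨1, by norm_num, Or.inr (Or.inr (Or.inr (Or.inl (by omega))))⟩
  h2' := fun j _ _ => ⟨4, by norm_num, Or.inr (Or.inr (Or.inr (Or.inr (Or.inr (Or.inr (Or.inr (Or.inr (Or.inr (Or.inr (Or.inl (by omega)))))))))))⟩
  h3 := ⟨0, by norm_num, Or.inr (Or.inl (by omega))⟩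
  h4 := ⟨1, by norm_num, Or.inr (Or.inr (Or.inr (Or.inr (Or.inl (by omega)))))⟩
  h5 := by
    intro j t s hj ht
    rcases Nat.mod_two_eq_zero_or_one j with h | h
    · exact ⟨2, by norm_num, Or.inr (Or.inr (Or.inr (Or.inr (Or.inr (Or.inl (by omega))))))⟩
    · exact ⟨3, by norm_num, Or.inr (Or.inr (Or.inr (Or.inr (Or.inr (Or.inr (Or.inl (by omega)))))))⟩
  h6 := fun t s _ => ⟨3, by norm_num, Or.inr (Or.inr (Or.inr (Or.inr (Or.inr (Or.inr (Or.inr (Or.inl (by omega))))))))⟩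
  h7 := ⟨3, by norm_num, Or.inr (Or.inr (Or.inr (Or.inr (Or.inr (Or.inr (Or.inr (Or.inr (Or.inl (by omega)))))))))⟩
  h8 := ⟨4, by norm_num, Or.inr (Or.inr (Or.inr (Or.inr (Or.inr (Or.inr (Or.inr (Or.inr (Or.inr (Or.inr (Or.inr (by omega)))))))))))⟩

theorem place_lt {k : ℕ} (hk : 0 < k) (j i : ℕ) (hi : i < k) : place k j i < k := by
  unfold place; split_ifs <;> omega

theorem place_inj {k j i i' : ℕ} (hi : i < k) (hi' : i' < k)
    (h : place k j i = place k j i') : i = i' := by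
  unfold place at h; split_ifs at h <;> omega

theorem lex_iff {k j t l s : ℕ} (ht : t < k) (hs : s < k) :
    posLt j t l s ↔ j * k + t < l * k + s := by
  unfold posLt
  rcases lt_trichotomy j l with h | h | h
  · have : (j + 1) * k ≤ l * k := Nat.mul_le_mul_right k h
    rw [add_mul] at this
    constructor
    · intro _; omega
    · intro _; exact Or.inl h
  · subst h
    constructor
    · intro h; omega
    · intro h; right; omega
  · have : (l + 1) * k ≤ j * k := Nat.mul_le_mul_right k h
    rw [add_mul] at this
    constructor <;> intro _ <;> omega

theorem posNum_inj {k u v : ℕ} (hk : 0 < k) (h : posNum k u = posNum k v) : u = v := by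
  unfold posNum at h
  have hu := Nat.mod_lt u hk
  have hv := Nat.mod_lt v hk
  have h1 := place_lt hk (u / k) _ hu
  have h2 := place_lt hk (v / k) _ hv
  have e1 := lex_iff (j := u / k) (l := v / k) h1 h2
  have e2 := lex_iff (j := v / k) (l := u / k) h2 h1
  unfold posLt at e1 e2
  have hj : u / k = v / k := by omega
  rw [hj] at h
  have := place_inj hu hv (by omega : place k (v / k) (u % k) = place k (v / k) (v % k))
  rw [← Nat.div_add_mod u k, ← Nat.div_add_mod v k, hj, this]

theorem posNum_lt {a k v : ℕ} (hk : 0 < k) (ha : a % 2 = 0) (hv : v < a * k + 1) :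
    posNum k v < a * k + 1 := by
  unfold posNum
  have hm := Nat.mod_lt v hk
  have h1 := place_lt hk (v / k) _ hm
  rcases Nat.lt_or_ge v (a * k) with h | h
  · have : v / k + 1 ≤ a := (Nat.div_lt_iff_lt_mul hk).2 h
    have := Nat.mul_le_mul_right k this
    rw [add_mul] at this
    omega
  · have : v = a * k := by omega
    subst this
    rw [Nat.mul_div_cancel _ hk, Nat.mul_mod_left]
    simp [place, ha]

/-- Page membership for vertices. -/
def vPage (k : ℕ) (Q : ℕ → ℕ → ℕ → ℕ → ℕ → Prop) (c u v : ℕ) : Prop :=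
  Q c (u / k) (place k (u / k) (u % k)) (v / k) (place k (v / k) (v % k))

theorem vPage_ok {a k : ℕ} {Q : ℕ → ℕ → ℕ → ℕ → ℕ → Prop} (hk : 0 < k) (hQ : GoodPages a k Q)
    {c u v x y : ℕ} (h : vPage k Q c u v) (h' : vPage k Q c x y) :
    posNum k u < posNum k v ∧
    ((posNum k u = posNum k x ∧ posNum k v = posNum k y) ∨ posNum k v < posNum k x ∨
      posNum k y < posNum k u ∨ (posNum k u < posNum k x ∧ posNum k y < posNum k v) ∨
      (posNum k x < posNum k u ∧ posNum k v < posNum k y)) := by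
  have hp : ∀ w, place k (w / k) (w % k) < k := fun w => place_lt hk _ _ (Nat.mod_lt w hk)
  obtain ⟨h1, h2⟩ := hQ.ok h h'
  unfold chordsOk at h2
  simp only [lex_iff (hp _) (hp _)] at h1 h2
  refine ⟨h1, ?_⟩
  rcases h2 with ⟨e1, e2, e3, e4⟩ | h2
  · left
    unfold posNum
    rw [e2, e4, e1, e3]; exact ⟨rfl, rfl⟩
  · exact Or.inr h2

theorem vPage_iff {k : ℕ} (hk : 0 < k) (Q : ℕ → ℕ → ℕ → ℕ → ℕ → Prop) (c j i l m : ℕ)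
    (hi : i < k) (hm : m < k) :
    vPage k Q c (j * k + i) (l * k + m) ↔ Q c j (place k j i) l (place k l m) := by
  have hd : ∀ j i, i < k → (j * k + i) / k = j := fun j i hi => by
    rw [add_comm, Nat.add_mul_div_right _ _ hk, Nat.div_eq_of_lt hi, zero_add]
  have hmod : ∀ j i, i < k → (j * k + i) % k = i := fun j i hi => by
    rw [add_comm, Nat.add_mul_mod_self_right, Nat.mod_eq_of_lt hi]
  unfold vPage
  rw [hd _ _ hi, hd _ _ hm, hmod _ _ hi, hmod _ _ hm]

/-- `u` and `v` are joined by an edge in some page -/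
def covered (k : ℕ) (Q : ℕ → ℕ → ℕ → ℕ → ℕ → Prop) (u v : ℕ) : Prop :=
  ∃ c < 5, vPage k Q c u v ∨ vPage k Q c v u

theorem covered_of {k : ℕ} (hk : 0 < k) {Q : ℕ → ℕ → ℕ → ℕ → ℕ → Prop} (j i l m : ℕ)
    (hi : i < k) (hm : m < k)
    (h : (∃ c < 5, Q c j (place k j i) l (place k l m)) ∨
      (∃ c < 5, Q c l (place k l m) j (place k j i))) :
    covered k Q (j * k + i) (l * k + m) := by
  rcases h with ⟨c, hc, h⟩ | ⟨c, hc, h⟩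
  · exact ⟨c, hc, Or.inl ((vPage_iff hk Q c j i l m hi hm).2 h)⟩
  · exact ⟨c, hc, Or.inr ((vPage_iff hk Q c l m j i hm hi).2 h)⟩

theorem place_even {k j i : ℕ} (h : j % 2 = 0) : place k j i = i := by simp [place, h]
theorem place_odd {k j i : ℕ} (h : j % 2 = 1) : place k j i = k - 1 - i := by simp [place, h]

/-- Coordinates of a vertex. -/
theorem coords {a k m : ℕ} (hk : 0 < k) (hm : m < a * k + 1) :
    (∃ j i, j < a ∧ i < k ∧ m = j * k + i) ∨ m = a * k := by
  rcases Nat.lt_or_ge m (a * k) with h | h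
  · left
    refine ⟨m / k, m % k, (Nat.div_lt_iff_lt_mul hk).2 h, Nat.mod_lt _ hk, ?_⟩
    rw [mul_comm]; exact (Nat.div_add_mod m k).symm
  · right; omega

theorem cover_one {a k : ℕ} {Q : ℕ → ℕ → ℕ → ℕ → ℕ → Prop} (ha : a % 2 = 0) (ha2 : 2 ≤ a)
    (hk : 2 ≤ k) (hQ : GoodPages a k Q) (m : ℕ) (hm : m < a * k) : covered k Q m (m + 1) := by
  have hk0 : 0 < k := by omega
  rcases coords hk0 (by omega : m < a * k + 1) with ⟨j, i, hj, hi, rfl⟩ | h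
  · rcases Nat.lt_or_ge (i + 1) k with h1 | h1
    · apply covered_of hk0 j i j (i + 1) hi h1
      rcases Nat.mod_two_eq_zero_or_one j with h | h
      · left; rw [place_even h, place_even h]; exact hQ.h1 j i hj h1
      · right; rw [place_odd h, place_odd h]
        have := hQ.h1 j (k - 1 - (i + 1)) hj (by omega)
        rwa [show k - 1 - (i + 1) + 1 = k - 1 - i by omega] at this
    · have e : i = k - 1 := by omega
      subst e
      have : j * k + (k - 1) + 1 = (j + 1) * k + 0 := by rw [add_mul]; omega
      rw [this]
      apply covered_of hk0 j (k - 1) (j + 1) 0 hi hk0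
      left
      rcases Nat.lt_or_ge (j + 1) a with h2 | h2
      · rcases Nat.mod_two_eq_zero_or_one j with h | h
        · rw [place_even h, place_odd (by omega)]; exact hQ.h2 j h h2
        · rw [place_odd h, place_even (by omega), Nat.sub_self]; exact hQ.h2' j h h2
      · have e : j = a - 1 := by omega
        subst e
        rw [place_odd (by omega), place_even (by omega), Nat.sub_self,
          show a - 1 + 1 = a by omega]
        exact hQ.h3
  · omega

theorem cover_one' {a k : ℕ} {Q : ℕ → ℕ → ℕ → ℕ → ℕ → Prop} (ha : a % 2 = 0)
    (hk : 2 ≤ k) (hQ : GoodPages a k Q) : covered k Q (a * k) 0 := by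
  have hk0 : 0 < k := by omega
  have := covered_of (Q := Q) hk0 a 0 0 0 hk0 hk0
    (by right; rw [place_even ha, place_even rfl]; exact hQ.h4)
  simpa using this

theorem cover_k {a k : ℕ} {Q : ℕ → ℕ → ℕ → ℕ → ℕ → Prop} (ha : a % 2 = 0) (ha2 : 2 ≤ a)
    (hk : 2 ≤ k) (hQ : GoodPages a k Q) (m : ℕ) (hm : m + k < a * k + 1) :
    covered k Q m (m + k) := by
  have hk0 : 0 < k := by omega
  rcases coords hk0 (by omega : m < a * k + 1) with ⟨j, i, hj, hi, rfl⟩ | h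
  · have e : j * k + i + k = (j + 1) * k + i := by ring
    rw [e]
    apply covered_of hk0 j i (j + 1) i hi hi
    left
    rcases Nat.lt_or_ge (j + 1) a with h2 | h2
    · rcases Nat.mod_two_eq_zero_or_one j with h | h
      · rw [place_even h, place_odd (by omega)]; exact hQ.h5 j _ _ h2 (by omega)
      · rw [place_odd h, place_even (by omega)]; exact hQ.h5 j _ _ h2 (by omega)
    · have e : j = a - 1 := by omega
      subst e
      rw [show a - 1 + 1 = a by omega] at *
      have : i = 0 := by omega
      subst this
      rw [place_odd (by omega), place_even (by omega)]
      exact hQ.h7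
  · omega

theorem cover_k' {a k : ℕ} {Q : ℕ → ℕ → ℕ → ℕ → ℕ → Prop} (ha : a % 2 = 0) (ha2 : 2 ≤ a)
    (hk : 2 ≤ k) (hQ : GoodPages a k Q) (m : ℕ) (hm' : m < a * k + 1) (hm : a * k + 1 ≤ m + k) :
    covered k Q m (m + k - (a * k + 1)) := by
  have hk0 : 0 < k := by omega
  rcases coords hk0 hm' with ⟨j, i, hj, hi, rfl⟩ | h
  · have e : j = a - 1 := by
      by_contra hne
      have : (j + 2) * k ≤ a * k := Nat.mul_le_mul_right k (by omega)
      rw [add_mul] at this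
      omega
    subst e
    have e : (a - 1) * k + k = a * k := by
      conv_rhs => rw [show a = a - 1 + 1 by omega]
      ring
    have e2 : (a - 1) * k + i + k - (a * k + 1) = 0 * k + (i - 1) := by omega
    rw [e2]
    apply covered_of hk0 (a - 1) i 0 (i - 1) hi (by omega)
    right
    rw [place_even (j := 0) rfl, place_odd (by omega)]
    exact hQ.h6 _ _ (by omega)
  · subst h
    have := covered_of (Q := Q) hk0 a 0 0 (k - 1) hk0 (by omega)
      (by right; rw [place_even ha, place_even rfl]; exact hQ.h8)
    rw [show a * k + k - (a * k + 1) = 0 * k + (k - 1) by omega]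
    simpa using this

theorem covered_symm {k : ℕ} {Q : ℕ → ℕ → ℕ → ℕ → ℕ → Prop} {u v : ℕ} (h : covered k Q u v) :
    covered k Q v u := by
  obtain ⟨c, hc, h⟩ := h
  exact ⟨c, hc, h.symm⟩

theorem circ_adj {n k : ℕ} {u v : ZMod n} :
    (circ n k).Adj u v ↔ u ≠ v ∧ (v = u + 1 ∨ v = u + k ∨ u = v + 1 ∨ u = v + k) := by
  unfold circ circulant
  rw [SimpleGraph.fromRel_adj]
  simp only [Set.mem_insert_iff, Set.mem_singleton_iff, exists_eq_or_imp, exists_eq_left,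
    Int.cast_one, Int.cast_natCast, sub_eq_iff_eq_add]
  rw [add_comm 1 v, add_comm 1 u, add_comm (k : ZMod n) v, add_comm (k : ZMod n) u]
  tauto

theorem cover_all {a k : ℕ} {Q : ℕ → ℕ → ℕ → ℕ → ℕ → Prop} (ha : a % 2 = 0) (ha2 : 2 ≤ a)
    (hk : 2 ≤ k) (hQ : GoodPages a k Q) {u v : ZMod (a * k + 1)}
    (h : (circ (a * k + 1) k).Adj u v) : covered k Q u.val v.val := by
  have hak : 2 * k ≤ a * k := Nat.mul_le_mul_right k ha2
  have hone : ∀ u : ZMod (a * k + 1), covered k Q u.val (u + 1).val := by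
    intro u
    have hu := ZMod.val_lt u
    have h1 : (1 : ZMod (a * k + 1)).val = 1 := by
      rw [ZMod.val_one_eq_one_mod, Nat.mod_eq_of_lt (by omega)]
    rw [ZMod.val_add, h1]
    rcases Nat.lt_or_ge u.val (a * k) with h | h
    · rw [Nat.mod_eq_of_lt (by omega)]
      exact cover_one ha ha2 hk hQ _ h
    · have : u.val = a * k := by omega
      rw [this, Nat.mod_self]
      exact cover_one' ha hk hQ
  have hkk : ∀ u : ZMod (a * k + 1), covered k Q u.val (u + k).val := by
    intro u
    have hu := ZMod.val_lt u
    have h1 : (k : ZMod (a * k + 1)).val = k := ZMod.val_natCast_of_lt (by omega)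
    rw [ZMod.val_add, h1]
    rcases Nat.lt_or_ge (u.val + k) (a * k + 1) with h | h
    · rw [Nat.mod_eq_of_lt h]
      exact cover_k ha ha2 hk hQ _ h
    · rw [Nat.mod_eq_sub_mod h, Nat.mod_eq_of_lt (by omega)]
      exact cover_k' ha ha2 hk hQ _ hu h
  rcases (circ_adj.1 h).2 with rfl | rfl | rfl | rfl
  · exact hone _
  · exact hkk _
  · exact covered_symm (hone _)
  · exact covered_symm (hkk _)

theorem hasMBE_of_good {a k : ℕ} {Q : ℕ → ℕ → ℕ → ℕ → ℕ → Prop} (ha : a % 2 = 0) (ha2 : 2 ≤ a)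
    (hk : 2 ≤ k) (hQ : GoodPages a k Q) : HasMBE (circ (a * k + 1) k) 5 := by
  classical
  have hk0 : 0 < k := by omega
  set n := a * k + 1 with hn
  have hcard : Nat.card (ZMod n) = n := Nat.card_zmod n
  let f : ZMod n → Fin (Nat.card (ZMod n)) := fun v =>
    ⟨posNum k v.val, by rw [hcard]; exact posNum_lt hk0 ha (ZMod.val_lt v)⟩
  have finj : Function.Injective f := by
    intro u v h
    have := posNum_inj hk0 (congrArg Fin.val h)
    exact ZMod.val_injective n this
  have fbij : Function.Bijective f := by
    rw [Fintype.bijective_iff_injective_and_card]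
    exact ⟨finj, by simp⟩
  let P : ZMod n → ZMod n → Fin 5 → Prop := fun u v c =>
    vPage k Q c u.val v.val ∨ vPage k Q c v.val u.val
  have Psymm : ∀ u v, P u v = P v u := fun u v => by
    funext c; exact propext or_comm
  let col : ZMod n → ZMod n → Fin 5 := fun u v => Classical.epsilon (P u v)
  have hcol : ∀ u v, (circ n k).Adj u v → P u v (col u v) := by
    intro u v h
    obtain ⟨c, hc, h⟩ := cover_all ha ha2 hk hQ h
    exact Classical.epsilon_spec (p := P u v) ⟨⟨c, hc⟩, h⟩
  have key : ∀ (c : Fin 5) (u v x y : ZMod n), P u v c → P x y c →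
      (posNum k u.val = posNum k x.val ∧ posNum k v.val = posNum k y.val) ∨
      (posNum k u.val = posNum k y.val ∧ posNum k v.val = posNum k x.val) ∨
      (posNum k u.val ≠ posNum k x.val ∧ ¬ ChordCross (f u) (f v) (f x) (f y)) := by
    intro c u v x y h h'
    simp only [ChordCross, ChordBetween, Xor', Xor, Fin.lt_def, min_lt_iff, lt_max_iff, f,
      Fin.coe_min, Fin.coe_max]
    rcases h with h | h <;> rcases h' with h' | h' <;>
    · have h1 := vPage_ok hk0 hQ h h'
      have h2 := vPage_ok hk0 hQ h' h
      omega
  refine ⟨Equiv.ofBijective f fbij, col, ?_, ?_, ?_⟩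
  · intro u v _
    show Classical.epsilon (P u v) = Classical.epsilon (P v u)
    rw [Psymm]
  · intro u v w huv huw hvw heq
    have h1 := hcol u v huv
    have h2 := hcol u w huw
    rw [← heq] at h2
    apply hvw
    rcases key _ _ _ _ _ h1 h2 with h | h | h
    · exact ZMod.val_injective n (posNum_inj hk0 h.2)
    · exact ZMod.val_injective n (posNum_inj hk0 (h.2.trans h.1))
    · exact absurd rfl h.1
  · intro p q r s hpq hrs hx heq
    have h1 := hcol p q hpq
    have h2 := hcol r s hrs
    rw [← heq] at h2
    simp only [Equiv.ofBijective_apply] at hx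
    rcases key _ _ _ _ _ h1 h2 with h | h | h
    · simp only [ChordCross, ChordBetween, Xor', Xor, Fin.lt_def, Fin.coe_min, Fin.coe_max, f] at hx
      omega
    · simp only [ChordCross, ChordBetween, Xor', Xor, Fin.lt_def, Fin.coe_min, Fin.coe_max, f] at hx
      omega
    · exact h.2 hx

theorem hasMBE_of_even {a k : ℕ} (ha : a % 2 = 0) (ha2 : 2 ≤ a) (hk : 2 ≤ k) :
    HasMBE (circ (a * k + 1) k) 5 := by
  rcases Nat.mod_two_eq_zero_or_one k with h | h
  · exact hasMBE_of_good ha ha2 hk (goodPages_even ha ha2 h hk)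
  · exact hasMBE_of_good ha ha2 hk (goodPages_odd ha ha2 h (by omega))

theorem HasMBE.transfer {V : Type*} {G H : SimpleGraph V} {m : ℕ} (e : V ≃ V)
    (he : ∀ u v, G.Adj u v → H.Adj (e u) (e v)) (h : HasMBE H m) : HasMBE G m := by
  obtain ⟨σ, col, h1, h2, h3⟩ := h
  refine ⟨e.trans σ, fun u v => col (e u) (e v), ?_, ?_, ?_⟩
  · intro u v h; exact h1 _ _ (he _ _ h)
  · intro u v w h h' hne
    exact h2 _ _ _ (he _ _ h) (he _ _ h') (fun h => hne (e.injective h))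
  · intro p q r s h h' hx
    exact h3 _ _ _ _ (he _ _ h) (he _ _ h') hx

theorem hasMBE_swap {a k : ℕ} (h : HasMBE (circ (a * k + 1) k) 5) :
    HasMBE (circ (a * k + 1) a) 5 := by
  have hz : (a : ZMod (a * k + 1)) * k = -1 := by
    have : ((a * k + 1 : ℕ) : ZMod (a * k + 1)) = 0 := ZMod.natCast_self _
    push_cast at this
    exact eq_neg_of_add_eq_zero_left this
  let e : ZMod (a * k + 1) ≃ ZMod (a * k + 1) :=
    { toFun := fun x => k * x
      invFun := fun x => - a * x
      left_inv := fun x => by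
        show - (a : ZMod (a * k + 1)) * (k * x) = x
        linear_combination (-x) * hz
      right_inv := fun x => by
        show (k : ZMod (a * k + 1)) * (- a * x) = x
        linear_combination (-x) * hz }
  refine HasMBE.transfer e ?_ h
  intro u v huv
  rw [circ_adj] at huv ⊢
  refine ⟨fun h => huv.1 (e.injective h), ?_⟩
  show (k : ZMod (a * k + 1)) * v = k * u + 1 ∨ (k : ZMod (a * k + 1)) * v = k * u + k ∨
    (k : ZMod (a * k + 1)) * u = k * v + 1 ∨ (k : ZMod (a * k + 1)) * u = k * v + k
  rcases huv.2 with rfl | rfl | rfl | rfl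
  · right; left; ring
  · right; right; left; linear_combination -hz
  · right; right; right; ring
  · left; linear_combination -hz

theorem circ_nbrs {n k : ℕ} (hk : 2 ≤ k) (hn : 2 * k < n) (v : ZMod n) :
    ((circ n k).neighborSet v).ncard = 4 := by
  have hz : ∀ m : ℕ, 0 < m → m < n → (m : ZMod n) ≠ 0 := by
    intro m h0 h1 h
    rw [ZMod.natCast_eq_zero_iff] at h
    exact absurd (Nat.le_of_dvd h0 h) (by omega)
  have z1 := hz 1 (by omega) (by omega)
  have z2 := hz 2 (by omega) (by omega)
  have zk := hz k (by omega) (by omega)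
  have zkk := hz (2 * k) (by omega) (by omega)
  have zp := hz (k + 1) (by omega) (by omega)
  have zm := hz (k - 1) (by omega) (by omega)
  rw [Nat.cast_sub (by omega)] at zm
  push_cast at z1 z2 zkk zp zm
  have : (circ n k).neighborSet v =
      (({v + 1, v - 1, v + k, v - k} : Finset (ZMod n)) : Set (ZMod n)) := by
    ext w
    simp only [SimpleGraph.mem_neighborSet, circ_adj, Finset.coe_insert, Finset.coe_singleton,
      Set.mem_insert_iff, Set.mem_singleton_iff]
    have e1 : v = w + 1 ↔ w = v - 1 := by
      constructor <;> intro h <;> linear_combination -h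
    have e2 : v = w + k ↔ w = v - k := by
      constructor <;> intro h <;> linear_combination -h
    rw [e1, e2]
    constructor
    · rintro ⟨_, h⟩; tauto
    · intro h
      refine ⟨?_, by tauto⟩
      rintro rfl
      rcases h with h | h | h | h
      · exact z1 (by linear_combination -h)
      · exact z1 (by linear_combination h)
      · exact zk (by linear_combination -h)
      · exact zk (by linear_combination h)
  rw [this, Set.ncard_coe_finset]
  rw [Finset.card_insert_of_notMem, Finset.card_insert_of_notMem, Finset.card_insert_of_notMem,
    Finset.card_singleton]
  · simp only [Finset.mem_singleton]
    intro h; exact zkk (by linear_combination h)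
  · simp only [Finset.mem_insert, Finset.mem_singleton, not_or]
    exact ⟨fun h => zp (by linear_combination -h), fun h => zm (by linear_combination h)⟩
  · simp only [Finset.mem_insert, Finset.mem_singleton, not_or]
    exact ⟨fun h => z2 (by linear_combination h), fun h => zm (by linear_combination -h),
      fun h => zp (by linear_combination h)⟩

theorem maxDeg_circ {n k : ℕ} (hk : 2 ≤ k) (hn : 2 * k < n) : maxDeg (circ n k) = 4 := by
  unfold maxDeg
  simp only [circ_nbrs hk hn, Set.range_const]
  exact csSup_singleton 4

theorem five_le {n k m : ℕ} (hodd : Odd n) (hk : 2 ≤ k) (hn : 2 * k < n)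
    (h : HasMBE (circ n k) m) : 5 ≤ m := by
  classical
  by_contra hm
  have : NeZero n := ⟨by omega⟩
  obtain ⟨σ, col, h1, h2, -⟩ := h
  let c : Fin m := col 0 0
  have hex : ∀ v, ∃ w, (circ n k).Adj v w ∧ col v w = c := by
    intro v
    have hinj : Set.InjOn (col v) ((circ n k).neighborSet v) := by
      intro x hx y hy hxy
      by_contra hne
      exact h2 v x y hx hy hne hxy
    have hc := Set.ncard_image_of_injOn hinj
    rw [circ_nbrs hk hn] at hc
    have hu : col v '' (circ n k).neighborSet v = Set.univ := by
      apply Set.eq_of_subset_of_ncard_le (Set.subset_univ _)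
      rw [hc, Set.ncard_univ, Nat.card_eq_fintype_card, Fintype.card_fin]
      omega
    have : c ∈ col v '' (circ n k).neighborSet v := by rw [hu]; trivial
    obtain ⟨w, hw, hwc⟩ := this
    exact ⟨w, hw, hwc⟩
  choose g hg hgc using hex
  have hinv : ∀ v, g (g v) = v := by
    intro v
    by_contra hne
    refine h2 (g v) (g (g v)) v (hg _) (hg v).symm hne ?_
    rw [hgc, ← h1 _ _ (hg v), hgc]
  have hs : ∑ _v : ZMod n, (1 : ZMod 2) = 0 := by
    refine Finset.sum_involution (fun v _ => g v) ?_ ?_ ?_ ?_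
    · intro v _; decide
    · intro v _ _ h; exact (hg v).ne h.symm
    · intro v _; exact Finset.mem_univ _
    · intro v _; exact hinv v
  rw [Finset.sum_const, Finset.card_univ, ZMod.card, nsmul_eq_mul, mul_one,
    ZMod.natCast_eq_zero_iff] at hs
  obtain ⟨r, hr⟩ := hodd
  omega

/-- for `n` odd with `n ≡ 1 (mod k)`, `mbt(C(n,k)) = Δ(C(n,k)) + 1 = 5`. -/
theorem stmt15 (n k : ℕ) (hodd : Odd n) (hk : 2 ≤ k) (hk' : k ≤ n / 2)
    (hr : n % k = 1) :
    mbt (circ n k) = maxDeg (circ n k) + 1 ∧ maxDeg (circ n k) + 1 = 5 := by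
  have hn : 2 * k < n := by
    obtain ⟨r, hr⟩ := hodd
    omega
  have hM := maxDeg_circ hk hn
  rw [hM]
  refine ⟨?_, rfl⟩
  have hE : HasMBE (circ n k) 5 := by
    obtain ⟨a, rfl⟩ : ∃ a, n = a * k + 1 := by
      refine ⟨n / k, ?_⟩
      have := Nat.div_add_mod n k
      rw [hr, mul_comm] at this
      exact this.symm
    have ha2 : 2 ≤ a := by
      by_contra h
      have : a * k ≤ 1 * k := Nat.mul_le_mul_right k (by omega)
      omega
    rcases Nat.even_or_odd a with ha | ha
    · exact hasMBE_of_even (Nat.even_iff.1 ha) ha2 hk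
    · have hke : Even k := by
        by_contra h
        rw [Nat.not_even_iff_odd] at h
        have := ha.mul h
        rw [Nat.odd_iff] at this hodd
        omega
      rw [mul_comm a k]
      exact hasMBE_swap (by
        have := hasMBE_of_even (Nat.even_iff.1 hke) hk ha2
        exact this)
  apply le_antisymm
  · exact Nat.sInf_le hE
  · exact le_csInf ⟨5, hE⟩ fun m hm => five_le hodd hk hn hm
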